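/- Let P be a standard parabolic submonoid of M satisfying Assumption 1 and let g be a P-ribbon. Then the set P^g = { p^g : p ∈ P } is a standard parabolic submonoid of M, and the map x ↦ x^g is a monoid isomorphism from P onto P^g. -/

import Mathlib

/-!
Common setting: Garside monoids, standard parabolic submonoids, heads,
ribbons, following Digne–Michel, "Ribbons in Garside monoids".
-/

namespace GarsidePaper

variable {M : Type*}

/-- `a` left-divides `b` : `b = a * c` for some `c`. -/
def LDvd [Monoid M] (a b : M) : Prop := ∃ c, b = a * c

/-- `a` right-divides `b` : `b = c * a` for some `c`. -/
def RDvd [Monoid M] (a b : M) : Prop := ∃ c, b = c * a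

/-- `a` is a factor of `b` : `a` left-divides a right-divisor of `b`. -/
def IsFactor [Monoid M] (a b : M) : Prop := ∃ c, LDvd a c ∧ RDvd c b

/-- A Garside structure on a (left- and right-) cancellative monoid `M`:
left/right gcds and lcms, Noetherianity, and a Garside element `Δ`. -/
structure GarsideStruct (M : Type*) [CancelMonoid M] where
  /-- left-gcd : gcd for the left-divisibility order -/
  lgcd : M → M → M
  lgcd_dvd_left : ∀ a b, LDvd (lgcd a b) a
  lgcd_dvd_right : ∀ a b, LDvd (lgcd a b) b
  lgcd_greatest : ∀ a b d, LDvd d a → LDvd d b → LDvd d (lgcd a b)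
  /-- right-lcm : lcm for the left-divisibility order -/
  rlcm : M → M → M
  ldvd_rlcm_left : ∀ a b, LDvd a (rlcm a b)
  ldvd_rlcm_right : ∀ a b, LDvd b (rlcm a b)
  rlcm_least : ∀ a b m, LDvd a m → LDvd b m → LDvd (rlcm a b) m
  /-- right-gcd : gcd for the right-divisibility order -/
  rgcd : M → M → M
  rgcd_dvd_left : ∀ a b, RDvd (rgcd a b) a
  rgcd_dvd_right : ∀ a b, RDvd (rgcd a b) b
  rgcd_greatest : ∀ a b d, RDvd d a → RDvd d b → RDvd d (rgcd a b)
  /-- left-lcm : lcm for the right-divisibility order -/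
  llcm : M → M → M
  rdvd_llcm_left : ∀ a b, RDvd a (llcm a b)
  rdvd_llcm_right : ∀ a b, RDvd b (llcm a b)
  llcm_least : ∀ a b m, RDvd a m → RDvd b m → RDvd (llcm a b) m
  /-- Noetherian: no infinite sequence where each term is a proper factor
  of the previous one. -/
  noetherian : WellFounded (fun a b : M => IsFactor a b ∧ a ≠ b)
  /-- the Garside element -/
  Δ : M
  /-- the left- and right-divisors of `Δ` coincide -/
  delta_balanced : ∀ a : M, LDvd a Δ ↔ RDvd a Δ
  /-- the divisors of `Δ` generate `M` -/
  delta_generates : Submonoid.closure {a : M | LDvd a Δ} = ⊤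

variable [CancelMonoid M]

/-- An atom: an element with no proper nontrivial divisor (factor). -/
def IsAtom' (a : M) : Prop := a ≠ 1 ∧ ∀ b : M, IsFactor b a → b = 1 ∨ b = a

/-- A standard parabolic submonoid: a submonoid closed under factors in which
every element of `M` has a maximal left-divisor (the left `P`-head) and a
maximal right-divisor (the right `P`-head) lying in `P`. -/
structure IsStdParabolic (P : Submonoid M) : Prop where
  factor_closed : ∀ a b : M, b ∈ P → IsFactor a b → a ∈ P
  exists_left_head : ∀ g : M, ∃ h, h ∈ P ∧ LDvd h g ∧
    ∀ h', h' ∈ P → LDvd h' g → LDvd h' h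
  exists_right_head : ∀ g : M, ∃ h, h ∈ P ∧ RDvd h g ∧
    ∀ h', h' ∈ P → RDvd h' g → RDvd h' h

/-- `h` is the left `P`-head `H_P g` of `g` : the maximal left-divisor of `g`
lying in `P`. -/
def IsLeftHead (P : Set M) (g h : M) : Prop :=
  h ∈ P ∧ LDvd h g ∧ ∀ h', h' ∈ P → LDvd h' g → LDvd h' h

/-- `h` is the right `P`-head of `g` : the maximal right-divisor of `g`
lying in `P`. -/
def IsRightHead (P : Set M) (g h : M) : Prop :=
  h ∈ P ∧ RDvd h g ∧ ∀ h', h' ∈ P → RDvd h' g → RDvd h' h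

/-- `g` is `P`-reduced : `H_P g = 1`, i.e. the only left-divisor of `g`
lying in `P` is `1`. -/
def PReduced (P : Set M) (g : M) : Prop := ∀ h ∈ P, LDvd h g → h = 1

/-- `P ^ g` is defined: `p ^ g` is defined (`g ≼ p * g`) for every `p ∈ P`. -/
def ConjSetDef (P : Set M) (g : M) : Prop := ∀ p ∈ P, LDvd g (p * g)

/-- The set `P ^ g = { p ^ g : p ∈ P }`, where `p ^ g` is the unique `c`
with `p * g = g * c`. -/
def conjSet (P : Set M) (g : M) : Set M := {c : M | ∃ p ∈ P, p * g = g * c}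

/-- A `P`-ribbon: a `P`-reduced element `g` such that `P ^ g` is defined. -/
def IsRibbon (P : Set M) (g : M) : Prop := PReduced P g ∧ ConjSetDef P g

/-- `P` is the smallest standard parabolic submonoid containing `S₁`. -/
def IsSmallestParabolicContaining (S₁ : Set M) (P : Submonoid M) : Prop :=
  IsStdParabolic P ∧ S₁ ⊆ (P : Set M) ∧
    ∀ Q : Submonoid M, IsStdParabolic Q → S₁ ⊆ (Q : Set M) → P ≤ Q

/-- Assumption 1: for any set `S₁` of atoms, the right-lcm of `S₁` is the
Garside element `Δ_{P₁} = H_{P₁}(Δ)` of the smallest standard parabolic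
submonoid `P₁` containing `S₁`. -/
def Assumption1 (G : GarsideStruct M) : Prop :=
  ∀ S₁ : Set M, (∀ s ∈ S₁, IsAtom' s) →
    ∀ P₁ : Submonoid M, IsSmallestParabolicContaining S₁ P₁ →
      ∀ d : M, IsLeftHead (P₁ : Set M) G.Δ d →
        (∀ s ∈ S₁, LDvd s d) ∧ ∀ m : M, (∀ s ∈ S₁, LDvd s m) → LDvd d m

/-- Assumption 2: some (positive) power of `Δ` is central. -/
def Assumption2 (G : GarsideStruct M) : Prop :=
  ∃ n : ℕ, 0 < n ∧ ∀ x : M, G.Δ ^ n * x = x * G.Δ ^ n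

/-- `v = v_{s,P}` : the element defined by `Δ_{P_s} = Δ_P * v`, where `P_s`
is the smallest standard parabolic submonoid containing `P` and `s`. -/
def IsVsp (G : GarsideStruct M) (P : Submonoid M) (s v : M) : Prop :=
  ∃ Ps : Submonoid M, IsSmallestParabolicContaining ((P : Set M) ∪ {s}) Ps ∧
    ∃ dP dPs : M, IsLeftHead (P : Set M) G.Δ dP ∧
      IsLeftHead (Ps : Set M) G.Δ dPs ∧ dPs = dP * v

section Divisibility

theorem IsFactor.of_eq {a b u w : M} (h : b = u * a * w) : IsFactor a b :=
  ⟨a * w, ⟨w, rfl⟩, ⟨u, by rw [h, mul_assoc]⟩⟩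

theorem IsFactor.exists_eq {a b : M} (h : IsFactor a b) : ∃ u w, b = u * a * w := by
  obtain ⟨c, ⟨w, rfl⟩, ⟨u, rfl⟩⟩ := h
  exact ⟨u, w, (mul_assoc _ _ _).symm⟩

theorem LDvd.isFactor {a b : M} (h : LDvd a b) : IsFactor a b := by
  obtain ⟨w, rfl⟩ := h
  exact IsFactor.of_eq (u := 1) (w := w) (by simp)

theorem RDvd.isFactor {a b : M} (h : RDvd a b) : IsFactor a b := by
  obtain ⟨u, rfl⟩ := h
  exact IsFactor.of_eq (u := u) (w := 1) (by simp)

theorem LDvd.trans {a b c : M} (h : LDvd a b) (h' : LDvd b c) : LDvd a c := by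
  obtain ⟨u, rfl⟩ := h
  obtain ⟨v, rfl⟩ := h'
  exact ⟨u * v, mul_assoc _ _ _⟩

theorem RDvd.trans {a b c : M} (h : RDvd a b) (h' : RDvd b c) : RDvd a c := by
  obtain ⟨u, rfl⟩ := h
  obtain ⟨v, rfl⟩ := h'
  exact ⟨v * u, (mul_assoc _ _ _).symm⟩

end Divisibility


theorem GarsideStruct.factor_antisymm (G : GarsideStruct M) {a b : M} (h : IsFactor a b)
    (h' : IsFactor b a) : a = b := by
  by_contra hne
  exact G.noetherian.asymmetric _ _ ⟨h, hne⟩ ⟨h', Ne.symm hne⟩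

theorem GarsideStruct.eq_one_of_factor_one (G : GarsideStruct M) {a : M} (h : IsFactor a 1) :
    a = 1 :=
  G.factor_antisymm h (LDvd.isFactor ⟨a, (one_mul a).symm⟩)

theorem GarsideStruct.eq_one_of_mul_eq_one_left (G : GarsideStruct M) {a b : M}
    (h : a * b = 1) : a = 1 :=
  G.eq_one_of_factor_one (LDvd.isFactor ⟨b, h.symm⟩)

/-- Peeling off nontrivial left divisors taken from a set `T` terminates. -/
theorem GarsideStruct.induction_of_left_divisors (G : GarsideStruct M) {T : Set M}
    (hT : ∀ x : M, x ≠ 1 → ∃ y ∈ T, y ≠ 1 ∧ LDvd y x) {P : Submonoid M}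
    (hP : IsStdParabolic P) {K : M → Prop} (one : K 1)
    (mul : ∀ y z, y ∈ T → y ∈ P → z ∈ P → K z → K (y * z)) : ∀ p ∈ P, K p := by
  intro p
  induction p using G.noetherian.induction with
  | _ p ih =>
    intro hp
    by_cases h1 : p = 1
    · exact h1 ▸ one
    obtain ⟨y, hyT, hy1, z, rfl⟩ := hT p h1
    have hz : IsFactor z (y * z) := RDvd.isFactor ⟨y, rfl⟩
    have hzP := hP.factor_closed _ _ hp hz
    refine mul y z hyT (hP.factor_closed _ _ hp (LDvd.isFactor ⟨z, rfl⟩)) hzP (ih z ⟨hz, ?_⟩ hzP)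
    intro h
    exact hy1 (mul_right_cancel (b := z) (by rw [one_mul]; exact h.symm))

theorem GarsideStruct.exists_simple_ldvd (G : GarsideStruct M) (x : M) (hx : x ≠ 1) :
    ∃ y ∈ {a : M | LDvd a G.Δ}, y ≠ 1 ∧ LDvd y x := by
  have hmem : x ∈ Submonoid.closure {a : M | LDvd a G.Δ} := by
    rw [G.delta_generates]; trivial
  induction hmem using Submonoid.closure_induction with
  | mem x h => exact ⟨x, h, hx, 1, (mul_one x).symm⟩
  | one => exact absurd rfl hx
  | mul x y _ _ ihx ihy =>
    by_cases h1 : x = 1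
    · subst h1
      rw [one_mul] at hx ⊢
      exact ihy hx
    · obtain ⟨z, hz, hz1, hzx⟩ := ihx h1
      exact ⟨z, hz, hz1, hzx.trans ⟨y, rfl⟩⟩

theorem GarsideStruct.exists_atom_ldvd (G : GarsideStruct M) (x : M) (hx : x ≠ 1) :
    ∃ y ∈ {a : M | IsAtom' a}, y ≠ 1 ∧ LDvd y x := by
  obtain ⟨a, ⟨ha1, hax⟩, hmin⟩ :=
    G.noetherian.has_min {a : M | a ≠ 1 ∧ LDvd a x} ⟨x, hx, 1, (mul_one x).symm⟩
  have key : ∀ b, LDvd b a → b = 1 ∨ b = a := by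
    intro b hb
    by_contra! h
    exact hmin b ⟨h.1, hb.trans hax⟩ ⟨hb.isFactor, h.2⟩
  refine ⟨a, ⟨ha1, fun b hb => ?_⟩, ha1, hax⟩
  obtain ⟨u, w, h⟩ := hb.exists_eq
  rcases key u ⟨b * w, by rw [h, mul_assoc]⟩ with rfl | rfl
  · exact key b ⟨w, by simpa using h⟩
  · left
    refine G.eq_one_of_mul_eq_one_left (b := w) (mul_left_cancel (a := u) ?_)
    rw [← mul_assoc, ← h, mul_one]

theorem GarsideStruct.atom_ldvd_delta (G : GarsideStruct M) {a : M} (ha : IsAtom' a) :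
    LDvd a G.Δ := by
  obtain ⟨y, hy, hy1, hya⟩ := G.exists_simple_ldvd a ha.1
  rcases ha.2 y hya.isFactor with h | h
  · exact absurd h hy1
  · exact h ▸ hy

theorem GarsideStruct.isStdParabolic_sInf (G : GarsideStruct M) {F : Set (Submonoid M)}
    (hF : ∀ P ∈ F, IsStdParabolic P) : IsStdParabolic (sInf F) where
  factor_closed a b hb hab := by
    rw [Submonoid.mem_sInf] at hb ⊢
    exact fun P hP => (hF P hP).factor_closed a b (hb P hP) hab
  exists_left_head g := by
    obtain ⟨k, ⟨h, hh, rfl⟩, hmin⟩ :=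
      G.noetherian.has_min {k : M | ∃ h ∈ sInf F, g = h * k} ⟨g, 1, one_mem _, (one_mul g).symm⟩
    refine ⟨h, hh, ⟨k, rfl⟩, fun h' hh' hd' => ?_⟩
    have hl : G.rlcm h h' ∈ sInf F := by
      rw [Submonoid.mem_sInf] at hh hh' ⊢
      intro P hP
      obtain ⟨m, hm, -, hmax⟩ := (hF P hP).exists_left_head (h * k)
      exact (hF P hP).factor_closed _ m hm
        (G.rlcm_least _ _ _ (hmax h (hh P hP) ⟨k, rfl⟩) (hmax h' (hh' P hP) hd')).isFactor
    obtain ⟨e, he⟩ := G.ldvd_rlcm_left h h'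
    obtain ⟨k₂, hk₂⟩ := G.rlcm_least h h' _ ⟨k, rfl⟩ hd'
    have hk : k = e * k₂ := mul_left_cancel (a := h) (by rw [hk₂, he, mul_assoc])
    have heq : k₂ = k := by
      by_contra hne
      exact hmin k₂ ⟨_, hl, hk₂⟩ ⟨RDvd.isFactor ⟨e, hk⟩, hne⟩
    have he1 : e = 1 := mul_right_cancel (b := k) (by rw [one_mul, ← heq, ← hk, heq])
    have := G.ldvd_rlcm_right h h'
    rwa [he, he1, mul_one] at this
  exists_right_head g := by
    obtain ⟨k, ⟨h, hh, rfl⟩, hmin⟩ :=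
      G.noetherian.has_min {k : M | ∃ h ∈ sInf F, g = k * h} ⟨g, 1, one_mem _, (mul_one g).symm⟩
    refine ⟨h, hh, ⟨k, rfl⟩, fun h' hh' hd' => ?_⟩
    have hl : G.llcm h h' ∈ sInf F := by
      rw [Submonoid.mem_sInf] at hh hh' ⊢
      intro P hP
      obtain ⟨m, hm, -, hmax⟩ := (hF P hP).exists_right_head (k * h)
      exact (hF P hP).factor_closed _ m hm
        (G.llcm_least _ _ _ (hmax h (hh P hP) ⟨k, rfl⟩) (hmax h' (hh' P hP) hd')).isFactor
    obtain ⟨e, he⟩ := G.rdvd_llcm_left h h'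
    obtain ⟨k₂, hk₂⟩ := G.llcm_least h h' _ ⟨k, rfl⟩ hd'
    have hk : k = k₂ * e := mul_right_cancel (b := h) (by rw [hk₂, he, mul_assoc])
    have heq : k₂ = k := by
      by_contra hne
      exact hmin k₂ ⟨_, hl, hk₂⟩ ⟨LDvd.isFactor ⟨e, hk⟩, hne⟩
    have he1 : e = 1 := mul_left_cancel (a := k) (by rw [mul_one, ← heq, ← hk, heq])
    have := G.rdvd_llcm_right h h'
    rwa [he, he1, one_mul] at this

theorem GarsideStruct.exists_smallestParabolic (G : GarsideStruct M) (S₁ : Set M) :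
    ∃ P : Submonoid M, IsSmallestParabolicContaining S₁ P := by
  refine ⟨sInf {Q | IsStdParabolic Q ∧ S₁ ⊆ (Q : Set M)},
    G.isStdParabolic_sInf fun Q hQ => hQ.1, fun x hx => ?_, fun Q hQ hS => sInf_le ⟨hQ, hS⟩⟩
  exact Submonoid.mem_sInf.2 fun Q hQ => hQ.2 hx

section Head

variable {P : Submonoid M} {d : M}

theorem IsLeftHead.isRightHead (G : GarsideStruct M) (hP : IsStdParabolic P)
    (hd : IsLeftHead (P : Set M) G.Δ d) : IsRightHead (P : Set M) G.Δ d := by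
  obtain ⟨d', hd'P, hd'Δ, hmax⟩ := hP.exists_right_head G.Δ
  have h1 : RDvd d d' := hmax d hd.1 ((G.delta_balanced d).1 hd.2.1)
  have h2 : LDvd d' d := hd.2.2 d' hd'P ((G.delta_balanced d').2 hd'Δ)
  obtain rfl := G.factor_antisymm h1.isFactor h2.isFactor
  exact ⟨hd'P, hd'Δ, hmax⟩

theorem IsLeftHead.ldvd_iff_rdvd (G : GarsideStruct M) (hP : IsStdParabolic P)
    (hd : IsLeftHead (P : Set M) G.Δ d) (a : M) : LDvd a d ↔ RDvd a d := by
  have hr := hd.isRightHead G hP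
  constructor
  · intro h
    exact hr.2.2 a (hP.factor_closed _ _ hd.1 h.isFactor)
      ((G.delta_balanced a).1 (h.trans hd.2.1))
  · intro h
    exact hd.2.2 a (hP.factor_closed _ _ hd.1 h.isFactor)
      ((G.delta_balanced a).2 (h.trans hr.2.1))

theorem IsLeftHead.exists_conj (G : GarsideStruct M) (hP : IsStdParabolic P)
    (hd : IsLeftHead (P : Set M) G.Δ d) : ∀ p ∈ P, ∃ q ∈ P, p * d = d * q := by
  refine G.induction_of_left_divisors G.exists_simple_ldvd hP ⟨1, one_mem _, by simp⟩ ?_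
  rintro x p hx hxP - ⟨q, hq, hpq⟩
  obtain ⟨y, hy⟩ := hd.2.2 x hxP hx
  obtain ⟨z, hz⟩ := (hd.ldvd_iff_rdvd G hP y).2 ⟨x, hy⟩
  have hzP : z ∈ P := hP.factor_closed _ _ hd.1 (RDvd.isFactor ⟨y, hz⟩)
  refine ⟨z * q, mul_mem hzP hq, ?_⟩
  calc x * p * d = x * d * q := by rw [mul_assoc, hpq, mul_assoc]
    _ = x * (y * z) * q := by rw [← hz]
    _ = d * (z * q) := by rw [← mul_assoc x, ← hy, mul_assoc]

theorem IsLeftHead.exists_conj_inv (G : GarsideStruct M) (hP : IsStdParabolic P)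
    (hd : IsLeftHead (P : Set M) G.Δ d) : ∀ q ∈ P, ∃ p ∈ P, p * d = d * q := by
  refine G.induction_of_left_divisors G.exists_simple_ldvd hP ⟨1, one_mem _, by simp⟩ ?_
  rintro z q hz hzP - ⟨p, hp, hpq⟩
  obtain ⟨y, hy⟩ := (hd.ldvd_iff_rdvd G hP z).1 (hd.2.2 z hzP hz)
  obtain ⟨x, hx⟩ := (hd.ldvd_iff_rdvd G hP y).1 ⟨z, hy⟩
  have hxP : x ∈ P := hP.factor_closed _ _ hd.1 (LDvd.isFactor ⟨y, hx⟩)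
  refine ⟨x * p, mul_mem hxP hp, ?_⟩
  calc x * p * d = x * d * q := by rw [mul_assoc, hpq, mul_assoc]
    _ = x * (y * z) * q := by rw [← hy]
    _ = d * (z * q) := by rw [← mul_assoc x, ← hx, mul_assoc]

end Head

section Conj

variable {P R : Submonoid M} {D g : M}

/-- The conjugate `P ^ g` as a submonoid. -/
def conjSubmonoid (P : Submonoid M) (g : M) : Submonoid M where
  carrier := conjSet (P : Set M) g
  one_mem' := ⟨1, one_mem _, by simp⟩
  mul_mem' := by
    rintro a b ⟨p, hp, h⟩ ⟨q, hq, h'⟩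
    exact ⟨p * q, mul_mem hp hq, by rw [mul_assoc, h', ← mul_assoc, h, mul_assoc]⟩

/-- If conjugation by `D` permutes a standard parabolic submonoid `R`, it sends standard
parabolic submonoids contained in `R` to standard parabolic submonoids. -/
theorem isStdParabolic_conjSubmonoid (hP : IsStdParabolic P) (hR : IsStdParabolic R)
    (hPR : P ≤ R) (hc : ∀ p ∈ R, ∃ q ∈ R, p * D = D * q)
    (hc' : ∀ q ∈ R, ∃ p ∈ R, p * D = D * q) : IsStdParabolic (conjSubmonoid P D) := by
  have comp : ∀ {a a' b b' : M}, a' * D = D * a → b' * D = D * b →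
      a' * b' * D = D * (a * b) := by
    intro a a' b b' ha hb
    rw [mul_assoc, hb, ← mul_assoc, ha, mul_assoc]
  have uniq : ∀ {a' b' c : M}, a' * D = D * c → b' * D = D * c → a' = b' :=
    fun ha hb => mul_right_cancel (ha.trans hb.symm)
  have uniq' : ∀ {a b c : M}, c * D = D * a → c * D = D * b → a = b :=
    fun ha hb => mul_left_cancel (ha.symm.trans hb)
  have hQR : ∀ c ∈ conjSubmonoid P D, c ∈ R := by
    rintro c ⟨p, hp, h⟩
    obtain ⟨q, hq, h'⟩ := hc p (hPR hp)
    exact uniq' h' h ▸ hq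
  refine ⟨?_, fun g => ?_, fun g => ?_⟩
  · rintro a b hb hab
    have hbR := hQR b hb
    obtain ⟨p, hp, hpb⟩ := hb
    have haR := hR.factor_closed _ _ hbR hab
    obtain ⟨u, w, rfl⟩ := hab.exists_eq
    have huR := hR.factor_closed u _ hbR (LDvd.isFactor ⟨a * w, mul_assoc _ _ _⟩)
    have hwR := hR.factor_closed w _ hbR (RDvd.isFactor ⟨u * a, rfl⟩)
    obtain ⟨u', -, hu⟩ := hc' u huR
    obtain ⟨a', -, ha⟩ := hc' a haR
    obtain ⟨w', -, hw⟩ := hc' w hwR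
    exact ⟨a', hP.factor_closed _ _ hp (IsFactor.of_eq (uniq hpb (comp (comp hu ha) hw))), ha⟩
  · obtain ⟨h, hhR, hhg, hmax⟩ := hR.exists_left_head g
    obtain ⟨h', hh'R, hh⟩ := hc' h hhR
    obtain ⟨k', hk'P, ⟨m', rfl⟩, hmax'⟩ := hP.exists_left_head h'
    obtain ⟨k, -, hk⟩ := hc k' (hPR hk'P)
    obtain ⟨m, -, hm⟩ := hc m' (hR.factor_closed _ _ hh'R (RDvd.isFactor ⟨k', rfl⟩))
    refine ⟨k, ⟨k', hk'P, hk⟩, LDvd.trans ⟨m, uniq' hh (comp hk hm)⟩ hhg, fun q hq hqg => ?_⟩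
    obtain ⟨r, rfl⟩ := hmax q (hQR q hq) hqg
    obtain ⟨q', hq'P, hqq⟩ := hq
    obtain ⟨r', -, hr⟩ := hc' r (hR.factor_closed _ _ hhR (RDvd.isFactor ⟨q, rfl⟩))
    obtain ⟨n', hn'⟩ := hmax' q' hq'P ⟨r', uniq hh (comp hqq hr)⟩
    obtain ⟨n, -, hn⟩ := hc n' (hR.factor_closed _ _ (hPR hk'P) (RDvd.isFactor ⟨q', hn'⟩))
    exact ⟨n, uniq' hk (hn' ▸ comp hqq hn)⟩
  · obtain ⟨h, hhR, hhg, hmax⟩ := hR.exists_right_head g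
    obtain ⟨h', hh'R, hh⟩ := hc' h hhR
    obtain ⟨k', hk'P, ⟨m', rfl⟩, hmax'⟩ := hP.exists_right_head h'
    obtain ⟨k, -, hk⟩ := hc k' (hPR hk'P)
    obtain ⟨m, -, hm⟩ := hc m' (hR.factor_closed _ _ hh'R (LDvd.isFactor ⟨k', rfl⟩))
    refine ⟨k, ⟨k', hk'P, hk⟩, RDvd.trans ⟨m, uniq' hh (comp hm hk)⟩ hhg, fun q hq hqg => ?_⟩
    obtain ⟨r, rfl⟩ := hmax q (hQR q hq) hqg
    obtain ⟨q', hq'P, hqq⟩ := hq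
    obtain ⟨r', -, hr⟩ := hc' r (hR.factor_closed _ _ hhR (LDvd.isFactor ⟨q, rfl⟩))
    obtain ⟨n', hn'⟩ := hmax' q' hq'P ⟨r', uniq hh (comp hr hqq)⟩
    obtain ⟨n, -, hn⟩ := hc n' (hR.factor_closed _ _ (hPR hk'P) (LDvd.isFactor ⟨q', hn'⟩))
    exact ⟨n, uniq' hk (hn' ▸ comp hn hqq)⟩

theorem conjSubmonoid_one (P : Submonoid M) : conjSubmonoid P 1 = P := by
  ext c
  constructor
  · rintro ⟨p, hp, h⟩
    rw [mul_one, one_mul] at h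
    exact h ▸ hp
  · exact fun hc => ⟨c, hc, by simp⟩

theorem conjSubmonoid_mul {v : M} (hv : ConjSetDef (P : Set M) v) :
    conjSubmonoid P (v * g) = conjSubmonoid (conjSubmonoid P v) g := by
  ext c
  constructor
  · rintro ⟨p, hp, h⟩
    obtain ⟨q, hq⟩ := hv p hp
    refine ⟨q, ⟨p, hp, hq⟩, mul_left_cancel (a := v) ?_⟩
    rw [← mul_assoc, ← hq, mul_assoc, h, mul_assoc]
  · rintro ⟨q, ⟨p, hp, hq⟩, h⟩
    exact ⟨p, hp, by rw [← mul_assoc, hq, mul_assoc, h, mul_assoc]⟩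

theorem IsRibbon.of_mul {v : M} (hg : IsRibbon (P : Set M) (v * g)) :
    IsRibbon (conjSubmonoid P v : Set M) g := by
  constructor
  · rintro q ⟨p, hp, hpq⟩ ⟨r, rfl⟩
    have h1 : p = 1 := hg.1 p hp ⟨v * r, by rw [← mul_assoc, ← hpq, mul_assoc]⟩
    rw [h1, one_mul] at hpq
    exact mul_left_cancel (a := v) (by rw [← hpq, mul_one])
  · rintro q ⟨p, hp, hpq⟩
    obtain ⟨c, hc⟩ := hg.2 p hp
    refine ⟨c, mul_left_cancel (a := v) ?_⟩
    rw [← mul_assoc, ← hpq, mul_assoc, hc, mul_assoc]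

/-- A nontrivial `P`-ribbon has a nontrivial left divisor `v` such that `P ^ v` is defined and
standard parabolic. -/
theorem IsRibbon.exists_ldvd (G : GarsideStruct M) (hA : Assumption1 G) (hP : IsStdParabolic P)
    (hg : IsRibbon (P : Set M) g) (hg1 : g ≠ 1) :
    ∃ v, v ≠ 1 ∧ LDvd v g ∧ ConjSetDef (P : Set M) v ∧ IsStdParabolic (conjSubmonoid P v) := by
  obtain ⟨s, hs, hs1, hsg⟩ := G.exists_atom_ldvd g hg1
  set S₁ : Set M := {a | IsAtom' a ∧ a ∈ P} ∪ {s} with hS₁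
  have hatoms : ∀ a ∈ S₁, IsAtom' a := by
    rintro a (ha | rfl)
    exacts [ha.1, hs]
  obtain ⟨R, hR⟩ := G.exists_smallestParabolic S₁
  obtain ⟨D, hD⟩ : ∃ D, IsLeftHead (R : Set M) G.Δ D := hR.1.exists_left_head G.Δ
  obtain ⟨d, hd⟩ : ∃ d, IsLeftHead (P : Set M) G.Δ d := hP.exists_left_head G.Δ
  obtain ⟨hSD, hDmin⟩ := hA S₁ hatoms R hR D hD
  have hPR : P ≤ R := by
    refine G.induction_of_left_divisors (K := (· ∈ R)) G.exists_atom_ldvd hP (one_mem _) ?_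
    exact fun y z hy hyP _ hz => mul_mem (hR.2.1 (Or.inl ⟨hy, hyP⟩)) hz
  obtain ⟨v, rfl⟩ : LDvd d D := hD.2.2 d (hPR hd.1) hd.2.1
  have hv : LDvd v g := by
    obtain ⟨w, hw⟩ : LDvd (d * v) (d * g) := by
      refine hDmin _ ?_
      rintro a (ha | rfl)
      · exact (hd.2.2 a ha.2 (G.atom_ldvd_delta ha.1)).trans ⟨g, rfl⟩
      · exact hsg.trans (hg.2 d hd.1)
    exact ⟨w, mul_left_cancel (a := d) (by rw [hw, mul_assoc])⟩
  have hcR := hD.exists_conj G hR.1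
  have hdef : ConjSetDef (P : Set M) v := by
    intro p hp
    obtain ⟨p₁, hp₁, h⟩ := hd.exists_conj_inv G hP p hp
    obtain ⟨c, -, hc⟩ := hcR p₁ (hPR hp₁)
    refine ⟨c, mul_left_cancel (a := d) ?_⟩
    rw [← mul_assoc, ← h, mul_assoc, hc, mul_assoc]
  have hdP : conjSubmonoid P d = P := by
    ext q
    constructor
    · rintro ⟨p, hp, h⟩
      obtain ⟨q', hq', h'⟩ := hd.exists_conj G hP p hp
      exact mul_left_cancel (h'.symm.trans h) ▸ hq'
    · exact fun hq => hd.exists_conj_inv G hP q hq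
  refine ⟨v, ?_, hv, hdef, ?_⟩
  · rintro rfl
    have hsd : LDvd s d := by simpa using hSD s (Or.inr rfl)
    exact hs1 (hg.1 s (hP.factor_closed _ _ hd.1 hsd.isFactor) hsg)
  · have := isStdParabolic_conjSubmonoid hP hR.1 hPR hcR (hD.exists_conj_inv G hR.1)
    rwa [conjSubmonoid_mul fun p hp => ?_, hdP] at this
    obtain ⟨q, -, h⟩ := hd.exists_conj G hP p hp
    exact ⟨q, h⟩

theorem IsRibbon.isStdParabolic_conjSubmonoid (G : GarsideStruct M) (hA : Assumption1 G)
    (hP : IsStdParabolic P) (hg : IsRibbon (P : Set M) g) :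
    IsStdParabolic (conjSubmonoid P g) := by
  induction g using G.noetherian.induction generalizing P with
  | _ g ih =>
    by_cases hg1 : g = 1
    · rwa [hg1, conjSubmonoid_one]
    obtain ⟨v, hv1, ⟨g', rfl⟩, hdef, hstd⟩ := hg.exists_ldvd G hA hP hg1
    rw [conjSubmonoid_mul hdef]
    refine ih g' ⟨RDvd.isFactor ⟨v, rfl⟩, fun h => hv1 ?_⟩ hstd hg.of_mul
    exact mul_right_cancel (b := g') (by rw [one_mul]; exact h.symm)

theorem exists_mulEquiv_conjSubmonoid (hg : ConjSetDef (P : Set M) g) :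
    ∃ φ : P ≃* conjSubmonoid P g, ∀ p : P, (p : M) * g = g * (φ p : M) := by
  choose f hf using fun p : P => hg p p.2
  refine ⟨MulEquiv.ofBijective
    (MulHom.mk (fun p => (⟨f p, p, p.2, hf p⟩ : conjSubmonoid P g)) fun p q => ?_)
    ⟨fun p q h => ?_, ?_⟩, hf⟩
  · refine Subtype.ext (mul_left_cancel (a := g) ?_)
    calc g * f (p * q) = p * q * g := (hf (p * q)).symm
      _ = p * (q * g) := mul_assoc _ _ _
      _ = g * (f p * f q) := by rw [hf q, ← mul_assoc, hf p, mul_assoc]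
  · have h' : f p = f q := congrArg Subtype.val h
    exact Subtype.ext (mul_right_cancel (b := g) (by rw [hf p, hf q, h']))
  · rintro ⟨c, p, hp, h⟩
    exact ⟨⟨p, hp⟩, Subtype.ext (mul_left_cancel ((hf ⟨p, hp⟩).symm.trans h))⟩

end Conj

/-- if `g` is a `P`-ribbon then `P ^ g` is a standard parabolic
submonoid, and `x ↦ x ^ g` is a monoid isomorphism from `P` onto `P ^ g`. -/
theorem statement3 (G : GarsideStruct M) (hA : Assumption1 G)
    (P : Submonoid M) (hP : IsStdParabolic P)
    (g : M) (hg : IsRibbon (P : Set M) g) :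
    ∃ Q : Submonoid M, (Q : Set M) = conjSet (P : Set M) g ∧ IsStdParabolic Q ∧
      ∃ φ : P ≃* Q, ∀ p : P, (p : M) * g = g * (φ p : M) := by
  exact ⟨conjSubmonoid P g, rfl, hg.isStdParabolic_conjSubmonoid G hA hP,
    exists_mulEquiv_conjSubmonoid hg.2⟩

end GarsidePaper
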